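/- arXiv:1106.3381 — 7 statements merged into one kernel-verified Lean document; each statement's English description precedes it below -/
import Mathlib

section
/- Let {Y_n} be a sequence of real random variables with density functions {p_n}, Y a random variable with density p, and 𝒜 ⊂ ℝ a set of Lebesgue measure zero. Suppose: (1) sup_{x ∈ ℝ∖𝒜} |p_n(x) − p(x)| → 0 as n → ∞; (2) there exists M > 0 with p_n(x) ≤ M for all n and all x ∈ ℝ∖𝒜; (3) for every α > 0 there exists M_α > 0 with ∫_ℝ p_n^α(x) dx ≤ M_α for all n. Then for every α > 0 with α ≠ 1, the Rényi entropy of order α converges: (1/(1-α)) log ∫_ℝ p_n^α(x) dx → (1/(1-α)) log ∫_ℝ p^α(x) dx as n → ∞. -/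
open MeasureTheory ProbabilityTheory Filter

/-- Key step: uniform convergence and bounded `β`-integrals give convergence of `α`-integrals. -/
lemma renyi_aux (p : ℕ → ℝ → ℝ) (q : ℝ → ℝ)
    (hp_nonneg : ∀ n x, 0 ≤ p n x) (hp_meas : ∀ n, Measurable (p n))
    (hq_nonneg : ∀ x, 0 ≤ q x) (hq_meas : Measurable q)
    (A : Set ℝ) (hA : volume A = 0)
    (h1 : ∀ ε : ℝ, 0 < ε → ∃ N : ℕ, ∀ n : ℕ, N ≤ n → ∀ x ∉ A, |p n x - q x| < ε)
    (h2 : ∃ M : ℝ, 0 < M ∧ ∀ n : ℕ, ∀ x ∉ A, p n x ≤ M)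
    (h3 : ∀ α : ℝ, 0 < α → ∃ Mα : ℝ, 0 < Mα ∧ ∀ n : ℕ,
      ∫⁻ x, ENNReal.ofReal ((p n x) ^ α) ≤ ENNReal.ofReal Mα)
    (α : ℝ) (hα : 0 < α) :
    Integrable (fun x => q x ^ α) ∧ (∀ n, Integrable (fun x => p n x ^ α)) ∧
    Tendsto (fun n => ∫ x, (p n x) ^ α) atTop (nhds (∫ x, (q x) ^ α)) := by
  have hae : ∀ᵐ x : ℝ, x ∉ A := measure_eq_zero_iff_ae_notMem.mp hA
  have hpt : ∀ x ∉ A, Tendsto (fun n => p n x) atTop (nhds (q x)) := by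
    intro x hx
    rw [Metric.tendsto_atTop]
    intro ε hε
    obtain ⟨N, hN⟩ := h1 ε hε
    exact ⟨N, fun n hn => by rw [Real.dist_eq]; exact hN n hn x hx⟩
  obtain ⟨M, hM, hpM⟩ := h2
  have hqM : ∀ x ∉ A, q x ≤ M := fun x hx =>
    le_of_tendsto' (hpt x hx) (fun n => hpM n x hx)
  have hq3 : ∀ β : ℝ, 0 < β → ∀ C : ℝ,
      (∀ n : ℕ, ∫⁻ x, ENNReal.ofReal ((p n x) ^ β) ≤ ENNReal.ofReal C) →
      ∫⁻ x, ENNReal.ofReal ((q x) ^ β) ≤ ENNReal.ofReal C := by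
    intro β hβ C hC
    calc ∫⁻ x, ENNReal.ofReal ((q x) ^ β)
        = ∫⁻ x, liminf (fun n => ENNReal.ofReal ((p n x) ^ β)) atTop := by
          apply lintegral_congr_ae
          filter_upwards [hae] with x hx
          refine (Tendsto.liminf_eq ?_).symm
          exact ENNReal.tendsto_ofReal ((hpt x hx).rpow_const (Or.inr hβ.le))
      _ ≤ liminf (fun n => ∫⁻ x, ENNReal.ofReal ((p n x) ^ β)) atTop :=
          lintegral_liminf_le (fun n => ((hp_meas n).pow_const β).ennreal_ofReal)
      _ ≤ ENNReal.ofReal C := by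
          refine liminf_le_of_le (by isBoundedDefault) ?_
          intro b hb
          obtain ⟨n, hn⟩ := hb.exists
          exact hn.trans (hC n)
  have key : ∀ f : ℝ → ℝ, Measurable f → (∀ x, 0 ≤ f x) → ∀ β C : ℝ, 0 < C →
      ∫⁻ x, ENNReal.ofReal ((f x) ^ β) ≤ ENNReal.ofReal C →
      Integrable (fun x => f x ^ β) ∧ ∫ x, f x ^ β ≤ C := by
    intro f hf h0 β C hC h
    have hnn : 0 ≤ᵐ[volume] fun x => f x ^ β :=
      ae_of_all _ fun x => Real.rpow_nonneg (h0 x) β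
    have hm : AEStronglyMeasurable (fun x => f x ^ β) volume :=
      (hf.pow_const β).aestronglyMeasurable
    refine ⟨⟨hm, ?_⟩, ?_⟩
    · rw [hasFiniteIntegral_iff_ofReal hnn]
      exact h.trans_lt ENNReal.ofReal_lt_top
    · rw [integral_eq_lintegral_of_nonneg_ae hnn hm]
      exact ENNReal.toReal_le_of_le_ofReal hC.le h
  obtain ⟨Cα, hCα, hα3⟩ := h3 α hα
  have hqi := (key q hq_meas hq_nonneg α Cα hCα (hq3 α hα Cα hα3)).1
  have hpi := fun n => (key (p n) (hp_meas n) (hp_nonneg n) α Cα hCα (hα3 n)).1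
  refine ⟨hqi, hpi, ?_⟩
  have hβ : 0 < α / 2 := by positivity
  obtain ⟨C, hC, hC3⟩ := h3 (α / 2) hβ
  obtain ⟨hqb, hqC⟩ := key q hq_meas hq_nonneg (α / 2) C hC (hq3 _ hβ C hC3)
  have hpb := fun n => key (p n) (hp_meas n) (hp_nonneg n) (α / 2) C hC (hC3 n)
  have huc : UniformContinuousOn (fun t : ℝ => t ^ (α / 2)) (Set.Icc 0 M) :=
    isCompact_Icc.uniformContinuousOn_of_continuous
      (Real.continuous_rpow_const hβ.le).continuousOn
  rw [Metric.uniformContinuousOn_iff] at huc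
  rw [Metric.tendsto_atTop]
  intro ε hε
  obtain ⟨δ, hδ, hd⟩ := huc (ε / (4 * C)) (by positivity)
  obtain ⟨N, hN⟩ := h1 δ hδ
  refine ⟨N, fun n hn => ?_⟩
  rw [Real.dist_eq, ← integral_sub (hpi n) hqi, ← Real.norm_eq_abs]
  have hsq : ∀ t : ℝ, 0 ≤ t → t ^ α = t ^ (α / 2) * t ^ (α / 2) := by
    intro t ht
    rw [← Real.rpow_add_of_nonneg ht hβ.le hβ.le, add_halves]
  calc ‖∫ x, (p n x ^ α - q x ^ α)‖
      ≤ ∫ x, (ε / (4 * C)) * (p n x ^ (α / 2) + q x ^ (α / 2)) := by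
        refine norm_integral_le_of_norm_le (((hpb n).1.add hqb).const_mul _) ?_
        filter_upwards [hae] with x hx
        have := hd (p n x) ⟨hp_nonneg n x, hpM n x hx⟩ (q x) ⟨hq_nonneg x, hqM x hx⟩
          (by rw [Real.dist_eq]; exact hN n hn x hx)
        rw [Real.dist_eq] at this
        have hs : 0 ≤ p n x ^ (α / 2) + q x ^ (α / 2) :=
          add_nonneg (Real.rpow_nonneg (hp_nonneg n x) _) (Real.rpow_nonneg (hq_nonneg x) _)
        rw [hsq _ (hp_nonneg n x), hsq _ (hq_nonneg x), mul_self_sub_mul_self, Real.norm_eq_abs,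
          abs_mul, abs_of_nonneg hs, mul_comm]
        exact mul_le_mul_of_nonneg_right this.le hs
    _ = (ε / (4 * C)) * (∫ x, p n x ^ (α / 2)) + (ε / (4 * C)) * ∫ x, q x ^ (α / 2) := by
        rw [integral_const_mul, integral_add (hpb n).1 hqb, mul_add]
    _ ≤ (ε / (4 * C)) * C + (ε / (4 * C)) * C := by
        have := (hpb n).2
        gcongr
    _ = ε / 2 := by field_simp; ring
    _ < ε := by linarith

/-- **Continuity of Rényi entropy (Theorem 1, Rényi case).**
If densities `p n` of `Y n` converge uniformly off a null set to the density `q`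
of `Y`, are uniformly bounded off that null set, and have uniformly bounded
`α`-integrals for every `α > 0`, then for every `α > 0`, `α ≠ 1`, the Rényi
entropies of order `α` converge. -/
theorem renyi_entropy_continuity
    {Ω : Type*} [MeasureSpace Ω] [IsProbabilityMeasure (ℙ : Measure Ω)]
    (Y : ℕ → Ω → ℝ) (Z : Ω → ℝ)
    (p : ℕ → ℝ → ℝ) (q : ℝ → ℝ)
    (hp_nonneg : ∀ n x, 0 ≤ p n x) (hp_meas : ∀ n, Measurable (p n))
    (hq_nonneg : ∀ x, 0 ≤ q x) (hq_meas : Measurable q)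
    (hY : ∀ n, Measure.map (Y n) ℙ
      = volume.withDensity (fun x => ENNReal.ofReal (p n x)))
    (hZ : Measure.map Z ℙ = volume.withDensity (fun x => ENNReal.ofReal (q x)))
    (A : Set ℝ) (hA : volume A = 0)
    (h1 : ∀ ε : ℝ, 0 < ε → ∃ N : ℕ, ∀ n : ℕ, N ≤ n → ∀ x ∉ A, |p n x - q x| < ε)
    (h2 : ∃ M : ℝ, 0 < M ∧ ∀ n : ℕ, ∀ x ∉ A, p n x ≤ M)
    (h3 : ∀ α : ℝ, 0 < α → ∃ Mα : ℝ, 0 < Mα ∧ ∀ n : ℕ,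
      ∫⁻ x, ENNReal.ofReal ((p n x) ^ α) ≤ ENNReal.ofReal Mα) :
    ∀ α : ℝ, 0 < α → α ≠ 1 →
      Tendsto (fun n => (1 / (1 - α)) * Real.log (∫ x, (p n x) ^ α))
        atTop (nhds ((1 / (1 - α)) * Real.log (∫ x, (q x) ^ α))) := by
  intro α hα _
  have aux := renyi_aux p q hp_nonneg hp_meas hq_nonneg hq_meas A hA h1 h2 h3
  obtain ⟨hqi, hpi, hlim⟩ := aux α hα
  refine Tendsto.const_mul _ ?_
  by_cases h0 : ∫ x, q x ^ α = 0
  · -- degenerate case: `q = 0` almost everywhere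
    have hq0 : q =ᵐ[volume] 0 := by
      have := (integral_eq_zero_iff_of_nonneg
        (fun x => Real.rpow_nonneg (hq_nonneg x) α) hqi).mp h0
      filter_upwards [this] with x hx
      exact ((Real.rpow_eq_zero (hq_nonneg x) hα.ne').mp hx)
    obtain ⟨_, hpi1, hlim1⟩ := aux 1 one_pos
    simp only [Real.rpow_one] at hpi1 hlim1
    rw [integral_congr_ae hq0] at hlim1
    simp only [Pi.zero_apply, integral_zero] at hlim1
    have hev : ∀ᶠ n in atTop, ∫ x, p n x < 1 := hlim1.eventually (gt_mem_nhds one_pos)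
    rw [h0]
    refine tendsto_const_nhds.congr' ?_
    filter_upwards [hev] with n hn
    have htot : Measure.map (Y n) ℙ Set.univ = ENNReal.ofReal (∫ x, p n x) := by
      rw [hY n, withDensity_apply _ MeasurableSet.univ, Measure.restrict_univ,
        ofReal_integral_eq_lintegral_ofReal (hpi1 n) (ae_of_all _ (hp_nonneg n))]
    by_cases hm : AEMeasurable (Y n) ℙ
    · exfalso
      rw [Measure.map_apply_of_aemeasurable hm MeasurableSet.univ, Set.preimage_univ,
        measure_univ] at htot
      have : ENNReal.ofReal (∫ x, p n x) < 1 := by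
        rw [ENNReal.ofReal_lt_one]; exact hn
      exact absurd htot this.ne'
    · rw [Measure.map_of_not_aemeasurable hm] at htot
      have hz : ∫ x, p n x = 0 := by
        apply le_antisymm _ (integral_nonneg (hp_nonneg n))
        exact ENNReal.ofReal_eq_zero.mp htot.symm
      have hp0 := (integral_eq_zero_iff_of_nonneg (hp_nonneg n) (hpi1 n)).mp hz
      have : ∫ x, p n x ^ α = 0 := by
        rw [← integral_zero ℝ ℝ]
        apply integral_congr_ae
        filter_upwards [hp0] with x hx
        rw [hx, Pi.zero_apply, Real.zero_rpow hα.ne']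
      rw [this]
  · exact hlim.log h0
end

section
/- Let {Y_n} be a sequence of real random variables with density functions {p_n}, Y a random variable with density p, and 𝒜 ⊂ ℝ a set of Lebesgue measure zero. Suppose: (1) sup_{x ∈ ℝ∖𝒜} |p_n(x) − p(x)| → 0 as n → ∞; (2) there exists M > 0 with p_n(x) ≤ M for all n and all x ∈ ℝ∖𝒜; (3) for every α > 0 there exists M_α > 0 with ∫_ℝ p_n^α(x) dx ≤ M_α for all n. Then for every α > 0 with α ≠ 1, the Tsallis entropy of order α converges: (1/(α-1))(1 − ∫_ℝ p_n^α(x) dx) → (1/(α-1))(1 − ∫_ℝ p^α(x) dx) as n → ∞. -/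
open MeasureTheory ProbabilityTheory Filter

/-- **Continuity of Tsallis entropy (Theorem 1, Tsallis case).** -/
theorem tsallis_entropy_continuity
    {Ω : Type*} [MeasureSpace Ω] [IsProbabilityMeasure (ℙ : Measure Ω)]
    (Y : ℕ → Ω → ℝ) (Z : Ω → ℝ)
    (p : ℕ → ℝ → ℝ) (q : ℝ → ℝ)
    (hp_nonneg : ∀ n x, 0 ≤ p n x) (hp_meas : ∀ n, Measurable (p n))
    (hq_nonneg : ∀ x, 0 ≤ q x) (hq_meas : Measurable q)
    (hY : ∀ n, Measure.map (Y n) ℙ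
      = volume.withDensity (fun x => ENNReal.ofReal (p n x)))
    (hZ : Measure.map Z ℙ = volume.withDensity (fun x => ENNReal.ofReal (q x)))
    (A : Set ℝ) (hA : volume A = 0)
    (h1 : ∀ ε : ℝ, 0 < ε → ∃ N : ℕ, ∀ n : ℕ, N ≤ n → ∀ x ∉ A, |p n x - q x| < ε)
    (h2 : ∃ M : ℝ, 0 < M ∧ ∀ n : ℕ, ∀ x ∉ A, p n x ≤ M)
    (h3 : ∀ α : ℝ, 0 < α → ∃ Mα : ℝ, 0 < Mα ∧ ∀ n : ℕ,
      ∫⁻ x, ENNReal.ofReal ((p n x) ^ α) ≤ ENNReal.ofReal Mα) :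
    ∀ α : ℝ, 0 < α → α ≠ 1 →
      Tendsto (fun n => (1 / (α - 1)) * (1 - ∫ x, (p n x) ^ α))
        atTop (nhds ((1 / (α - 1)) * (1 - ∫ x, (q x) ^ α))) := by
  intro α hα _
  refine Tendsto.const_mul _ (Tendsto.const_sub _ ?_)
  have hae : ∀ᵐ x : ℝ, x ∉ A := measure_eq_zero_iff_ae_notMem.mp hA
  -- pointwise convergence off the null set
  have hpt : ∀ x ∉ A, Tendsto (fun n => p n x) atTop (nhds (q x)) := by
    intro x hx
    rw [Metric.tendsto_atTop]
    intro ε hε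
    obtain ⟨N, hN⟩ := h1 ε hε
    exact ⟨N, fun n hn => by rw [Real.dist_eq]; exact hN n hn x hx⟩
  obtain ⟨M, hM, hpM⟩ := h2
  have hqM : ∀ x ∉ A, q x ≤ M := fun x hx =>
    le_of_tendsto (hpt x hx) (Eventually.of_forall fun n => hpM n x hx)
  -- Fatou
  have hqL : ∀ γ : ℝ, 0 < γ → ∀ C : ℝ, (∀ n : ℕ,
      ∫⁻ x, ENNReal.ofReal ((p n x) ^ γ) ≤ ENNReal.ofReal C) →
      ∫⁻ x, ENNReal.ofReal ((q x) ^ γ) ≤ ENNReal.ofReal C := by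
    intro γ hγ C hC
    calc ∫⁻ x, ENNReal.ofReal ((q x) ^ γ)
        = ∫⁻ x, liminf (fun n => ENNReal.ofReal ((p n x) ^ γ)) atTop := by
          apply lintegral_congr_ae
          filter_upwards [hae] with x hx
          refine (Tendsto.liminf_eq ?_).symm
          exact ENNReal.tendsto_ofReal ((hpt x hx).rpow_const (Or.inr hγ.le))
      _ ≤ liminf (fun n => ∫⁻ x, ENNReal.ofReal ((p n x) ^ γ)) atTop :=
          lintegral_liminf_le fun n => ((hp_meas n).pow_const γ).ennreal_ofReal
      _ ≤ ENNReal.ofReal C := by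
          refine (liminf_le_liminf (Eventually.of_forall hC)).trans ?_
          simp
  have hint : ∀ (γ C : ℝ) (f : ℝ → ℝ), (∀ x, 0 ≤ f x) → Measurable f →
      0 < C → ∫⁻ x, ENNReal.ofReal ((f x) ^ γ) ≤ ENNReal.ofReal C →
      Integrable (fun x => (f x) ^ γ) ∧ ∫ x, (f x) ^ γ ≤ C := by
    intro γ C f hf hfm hC h
    have h0 : 0 ≤ᵐ[volume] fun x => (f x) ^ γ :=
      Eventually.of_forall fun x => Real.rpow_nonneg (hf x) γ
    have hm : AEStronglyMeasurable (fun x => (f x) ^ γ) volume :=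
      (hfm.pow_const γ).aestronglyMeasurable
    refine ⟨⟨hm, ?_⟩, ?_⟩
    · rw [hasFiniteIntegral_iff_ofReal h0]
      exact h.trans_lt ENNReal.ofReal_lt_top
    · rw [integral_eq_lintegral_of_nonneg_ae h0 hm]
      exact ENNReal.toReal_le_of_le_ofReal hC.le h
  obtain ⟨C, hC, hpC⟩ := h3 α hα
  have hβ : 0 < α / 2 := by linarith
  obtain ⟨D, hD, hpD⟩ := h3 (α / 2) hβ
  have ip := fun n => (hint α C (p n) (hp_nonneg n) (hp_meas n) hC (hpC n)).1
  have iq := (hint α C q hq_nonneg hq_meas hC (hqL α hα C hpC)).1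
  have jp := fun n => hint (α / 2) D (p n) (hp_nonneg n) (hp_meas n) hD (hpD n)
  have jq := hint (α / 2) D q hq_nonneg hq_meas hD (hqL (α / 2) hβ D hpD)
  have huc : UniformContinuousOn (fun t : ℝ => t ^ (α / 2)) (Set.Icc 0 M) :=
    isCompact_Icc.uniformContinuousOn_of_continuous
      (Real.continuous_rpow_const hβ.le).continuousOn
  rw [Metric.uniformContinuousOn_iff] at huc
  rw [Metric.tendsto_atTop]
  intro ε hε
  obtain ⟨δ, hδ, hδ'⟩ := huc (ε / (4 * D)) (by positivity)
  obtain ⟨N, hN⟩ := h1 δ hδ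
  refine ⟨N, fun n hn => ?_⟩
  rw [Real.dist_eq, ← integral_sub (ip n) iq]
  have hsq : ∀ t : ℝ, 0 ≤ t → t ^ α = t ^ (α / 2) * t ^ (α / 2) := by
    intro t ht
    rw [← Real.rpow_add_of_nonneg ht hβ.le hβ.le]
    congr 1
    ring
  have hb : ∀ᵐ x : ℝ, ‖(p n x) ^ α - (q x) ^ α‖
      ≤ ε / (4 * D) * ((p n x) ^ (α / 2) + (q x) ^ (α / 2)) := by
    filter_upwards [hae] with x hx
    have h := hδ' (p n x) ⟨hp_nonneg n x, hpM n x hx⟩ (q x) ⟨hq_nonneg x, hqM x hx⟩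
      (by rw [Real.dist_eq]; exact hN n hn x hx)
    rw [Real.dist_eq] at h
    have e1 := Real.rpow_nonneg (hp_nonneg n x) (α / 2)
    have e2 := Real.rpow_nonneg (hq_nonneg x) (α / 2)
    have e3 : (p n x) ^ α - (q x) ^ α = ((p n x) ^ (α / 2) - (q x) ^ (α / 2))
        * ((p n x) ^ (α / 2) + (q x) ^ (α / 2)) := by
      rw [hsq _ (hp_nonneg n x), hsq _ (hq_nonneg x)]
      ring
    rw [Real.norm_eq_abs, e3, abs_mul, abs_of_nonneg (add_nonneg e1 e2)]
    exact mul_le_mul_of_nonneg_right h.le (add_nonneg e1 e2)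
  have hfin := norm_integral_le_of_norm_le (((jp n).1.add jq.1).const_mul (ε / (4 * D))) hb
  rw [Real.norm_eq_abs] at hfin
  refine hfin.trans_lt ?_
  have e : ∫ x, ε / (4 * D) * ((p n x) ^ (α / 2) + (q x) ^ (α / 2))
      = ε / (4 * D) * ((∫ x, (p n x) ^ (α / 2)) + ∫ x, (q x) ^ (α / 2)) := by
    rw [integral_const_mul, integral_add (jp n).1 jq.1]
  refine lt_of_eq_of_lt e ?_
  calc _ ≤ ε / (4 * D) * (D + D) := by
        apply mul_le_mul_of_nonneg_left (add_le_add (jp n).2 jq.2)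
        positivity
    _ = ε / 2 := by field_simp; ring
    _ < ε := by linarith
end

section
/- Let {Y_n} be a sequence of real random variables with density functions {p_n}, Y a random variable with density p, and 𝒜 ⊂ ℝ a set of Lebesgue measure zero. Suppose: (1) sup_{x ∈ ℝ∖𝒜} |p_n(x) − p(x)| → 0 as n → ∞; (2) there exists M > 0 with p_n(x) ≤ M for all n and all x ∈ ℝ∖𝒜; (3) for every α > 0 there exists M_α > 0 with ∫_ℝ p_n^α(x) dx ≤ M_α for all n. Then the Shannon entropies converge: -∫_ℝ p_n(x) log p_n(x) dx → -∫_ℝ p(x) log p(x) dx as n → ∞. -/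
open MeasureTheory ProbabilityTheory Filter

lemma aux_lip (K : ℝ) : ∃ L : ℝ, 0 < L ∧ ∀ x y : ℝ, 0 ≤ x → x ≤ K → 0 ≤ y → y ≤ K →
    |x * (x * Real.log x) - y * (y * Real.log y)| ≤ L * |x - y| := by
  have hc : Continuous (fun x : ℝ => 2 * (x * Real.log x) + x) := by
    have := Real.continuous_mul_log
    fun_prop
  obtain ⟨C, hC⟩ := (isCompact_Icc (a := (0:ℝ)) (b := K)).exists_bound_of_continuousOn
    hc.continuousOn
  have hchi : Continuous (fun x : ℝ => x * (x * Real.log x)) :=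
    continuous_id.mul Real.continuous_mul_log
  have hd : ∀ x : ℝ, 0 < x →
      HasDerivAt (fun x : ℝ => x * (x * Real.log x)) (2 * (x * Real.log x) + x) x := by
    intro x hx
    have h := (hasDerivAt_id x).mul ((hasDerivAt_id x).mul (Real.hasDerivAt_log hx.ne'))
    have h' : HasDerivAt (fun x : ℝ => x * (x * Real.log x)) _ x := h
    convert h' using 1
    simp
    field_simp
    ring
  have key : ∀ x y : ℝ, 0 ≤ x → x ≤ K → 0 ≤ y → y < x →
      |x * (x * Real.log x) - y * (y * Real.log y)| ≤ (|C| + 1) * |x - y| := by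
    intro x y hx hxK hy hyx
    obtain ⟨c, hc1, hc2⟩ := exists_deriv_eq_slope (fun x : ℝ => x * (x * Real.log x)) hyx
      hchi.continuousOn
      (fun z hz => (hd z (hy.trans_lt hz.1)).differentiableAt.differentiableWithinAt)
    have hcpos : 0 < c := hy.trans_lt hc1.1
    rw [(hd c hcpos).deriv] at hc2
    have hb := hC c ⟨hcpos.le, hc1.2.le.trans hxK⟩
    rw [hc2, Real.norm_eq_abs, abs_div, div_le_iff₀ (abs_pos.2 (sub_pos.2 hyx).ne')] at hb
    refine hb.trans (mul_le_mul_of_nonneg_right ?_ (abs_nonneg _))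
    linarith [le_abs_self C]
  refine ⟨|C| + 1, by positivity, ?_⟩
  intro x y hx hxK hy hyK
  rcases lt_trichotomy x y with h | h | h
  · rw [abs_sub_comm, abs_sub_comm x y]
    exact key y x hy hyK hx h
  · subst h; simp
  · exact key x y hx hxK hy h

lemma aux_key (K : ℝ) : ∃ L : ℝ, 0 < L ∧ ∀ u v : ℝ, 0 ≤ u → u ^ 2 ≤ K → 0 ≤ v → v ^ 2 ≤ K →
    |u ^ 4 * Real.log (u ^ 4) - v ^ 4 * Real.log (v ^ 4)| ≤ L * |u - v| * (u + v) := by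
  obtain ⟨L, hL, h⟩ := aux_lip K
  refine ⟨2 * L, by positivity, ?_⟩
  intro u v hu huK hv hvK
  have h1 := h (u ^ 2) (v ^ 2) (by positivity) huK (by positivity) hvK
  have e : ∀ u : ℝ, u ^ 4 * Real.log (u ^ 4) = 2 * (u ^ 2 * (u ^ 2 * Real.log (u ^ 2))) := by
    intro u
    rw [Real.log_pow, Real.log_pow]; push_cast; ring
  rw [e, e, ← mul_sub, abs_mul, abs_two]
  have e2 : |u ^ 2 - v ^ 2| = |u - v| * (u + v) := by
    rw [← abs_of_nonneg (add_nonneg hu hv), ← abs_mul]; congr 1; ring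
  rw [e2] at h1
  linarith

lemma aux_pow {u v : ℝ} (hu : 0 ≤ u) (hv : 0 ≤ v) : |u - v| ^ 4 ≤ |u ^ 4 - v ^ 4| := by
  have key : ∀ u v : ℝ, 0 ≤ v → v ≤ u → |u - v| ^ 4 ≤ |u ^ 4 - v ^ 4| := by
    intro u v hv h
    obtain ⟨d, hd, rfl⟩ : ∃ d, 0 ≤ d ∧ u = v + d := ⟨u - v, by linarith, by ring⟩
    have e : (v + d) ^ 4 - v ^ 4 = d ^ 4 + (4 * v ^ 3 * d + 6 * v ^ 2 * d ^ 2 + 4 * v * d ^ 3) := by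
      ring
    rw [add_sub_cancel_left, abs_of_nonneg hd, e, abs_of_nonneg (by positivity)]
    have : 0 ≤ 4 * v ^ 3 * d + 6 * v ^ 2 * d ^ 2 + 4 * v * d ^ 3 := by positivity
    linarith
  rcases le_total v u with h | h
  · exact key u v hv h
  · rw [abs_sub_comm, abs_sub_comm (u ^ 4)]; exact key v u hu h

/-- **Continuity of Shannon entropy (Theorem 1, case `α = 1`).** -/
theorem shannon_entropy_continuity
    {Ω : Type*} [MeasureSpace Ω] [IsProbabilityMeasure (ℙ : Measure Ω)]
    (Y : ℕ → Ω → ℝ) (Z : Ω → ℝ)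
    (p : ℕ → ℝ → ℝ) (q : ℝ → ℝ)
    (hp_nonneg : ∀ n x, 0 ≤ p n x) (hp_meas : ∀ n, Measurable (p n))
    (hq_nonneg : ∀ x, 0 ≤ q x) (hq_meas : Measurable q)
    (hY : ∀ n, Measure.map (Y n) ℙ
      = volume.withDensity (fun x => ENNReal.ofReal (p n x)))
    (hZ : Measure.map Z ℙ = volume.withDensity (fun x => ENNReal.ofReal (q x)))
    (A : Set ℝ) (hA : volume A = 0)
    (h1 : ∀ ε : ℝ, 0 < ε → ∃ N : ℕ, ∀ n : ℕ, N ≤ n → ∀ x ∉ A, |p n x - q x| < ε)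
    (h2 : ∃ M : ℝ, 0 < M ∧ ∀ n : ℕ, ∀ x ∉ A, p n x ≤ M)
    (h3 : ∀ α : ℝ, 0 < α → ∃ Mα : ℝ, 0 < Mα ∧ ∀ n : ℕ,
      ∫⁻ x, ENNReal.ofReal ((p n x) ^ α) ≤ ENNReal.ofReal Mα) :
    Tendsto (fun n => - ∫ x, p n x * Real.log (p n x))
      atTop (nhds (- ∫ x, q x * Real.log (q x))) := by
  obtain ⟨M, hM, hpM⟩ := h2
  obtain ⟨B, hB, hpB⟩ := h3 (1 / 4) (by norm_num)
  set u : ℕ → ℝ → ℝ := fun n x => (p n x) ^ (1 / 4 : ℝ) with hu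
  set v : ℝ → ℝ := fun x => (q x) ^ (1 / 4 : ℝ) with hv
  have hu0 : ∀ n x, 0 ≤ u n x := fun n x => Real.rpow_nonneg (hp_nonneg n x) _
  have hv0 : ∀ x, 0 ≤ v x := fun x => Real.rpow_nonneg (hq_nonneg x) _
  have hum : ∀ n, Measurable (u n) := fun n => (hp_meas n).pow_const _
  have hvm : Measurable v := hq_meas.pow_const _
  have e4 : ∀ a : ℝ, 0 ≤ a → (a ^ (1 / 4 : ℝ)) ^ 4 = a := by
    intro a ha
    rw [← Real.rpow_natCast, ← Real.rpow_mul ha]; norm_num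
  have hu4 : ∀ n x, u n x ^ 4 = p n x := fun n x => e4 _ (hp_nonneg n x)
  have hv4 : ∀ x, v x ^ 4 = q x := fun x => e4 _ (hq_nonneg x)
  have hae : ∀ᵐ x : ℝ, x ∉ A := measure_eq_zero_iff_ae_notMem.1 hA
  have hqM : ∀ x ∉ A, q x ≤ M + 1 := by
    obtain ⟨N, hN⟩ := h1 1 one_pos
    intro x hx
    have := abs_lt.1 (hN N le_rfl x hx)
    linarith [hpM N x hx]
  have sqb : ∀ a : ℝ, a ^ 4 ≤ M + 1 → a ^ 2 ≤ M + 1 := by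
    intro a ha
    nlinarith [sq_nonneg (a ^ 2 - 1), sq_nonneg (a ^ 2)]
  obtain ⟨L, hL, hkey⟩ := aux_key (M + 1)
  have hu2 : ∀ n, ∀ x ∉ A, u n x ^ 2 ≤ M + 1 := fun n x hx =>
    sqb _ (by rw [hu4]; linarith [hpM n x hx])
  have hv2 : ∀ x ∉ A, v x ^ 2 ≤ M + 1 := fun x hx => sqb _ (by rw [hv4]; exact hqM x hx)
  -- integrability
  have hui : ∀ n, Integrable (u n) := fun n => by
    refine ⟨(hum n).aestronglyMeasurable, ?_⟩
    rw [hasFiniteIntegral_iff_ofReal (Eventually.of_forall (hu0 n))]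
    exact (hpB n).trans_lt ENNReal.ofReal_lt_top
  have hlim : ∀ x ∉ A, Tendsto (fun n => u n x) atTop (nhds (v x)) := by
    intro x hx
    have : Tendsto (fun n => p n x) atTop (nhds (q x)) := by
      rw [Metric.tendsto_atTop]
      intro ε hε
      obtain ⟨N, hN⟩ := h1 ε hε
      exact ⟨N, fun n hn => hN n hn x hx⟩
    exact this.rpow_const (Or.inr (by norm_num))
  have hvB : ∫⁻ x, ENNReal.ofReal (v x) ≤ ENNReal.ofReal B := by
    calc ∫⁻ x, ENNReal.ofReal (v x)
        = ∫⁻ x, liminf (fun n => ENNReal.ofReal (u n x)) atTop := by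
          refine lintegral_congr_ae ?_
          filter_upwards [hae] with x hx
          exact ((ENNReal.tendsto_ofReal (hlim x hx)).liminf_eq).symm
      _ ≤ liminf (fun n => ∫⁻ x, ENNReal.ofReal (u n x)) atTop :=
          lintegral_liminf_le (fun n => (hum n).ennreal_ofReal)
      _ ≤ liminf (fun _ : ℕ => ENNReal.ofReal B) atTop :=
          liminf_le_liminf (Eventually.of_forall hpB)
      _ = ENNReal.ofReal B := by simp
  have hvi : Integrable v := by
    refine ⟨hvm.aestronglyMeasurable, ?_⟩
    rw [hasFiniteIntegral_iff_ofReal (Eventually.of_forall hv0)]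
    exact hvB.trans_lt ENNReal.ofReal_lt_top
  have huI : ∀ n, ∫ x, u n x ≤ B := fun n => by
    rw [integral_eq_lintegral_of_nonneg_ae (Eventually.of_forall (hu0 n))
      (hum n).aestronglyMeasurable]
    exact ENNReal.toReal_le_of_le_ofReal hB.le (hpB n)
  have hvI : ∫ x, v x ≤ B := by
    rw [integral_eq_lintegral_of_nonneg_ae (Eventually.of_forall hv0) hvm.aestronglyMeasurable]
    exact ENNReal.toReal_le_of_le_ofReal hB.le hvB
  have bnd : ∀ a : ℝ, 0 ≤ a → a ^ 2 ≤ M + 1 →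
      |a ^ 4 * Real.log (a ^ 4)| ≤ L * (M + 2) * a := by
    intro a ha ha2
    have := hkey a 0 ha ha2 le_rfl (by simp; linarith)
    simp only [ne_eq, OfNat.ofNat_ne_zero, not_false_eq_true, zero_pow, zero_mul, sub_zero,
      add_zero, abs_of_nonneg ha] at this
    have h3 : a ≤ M + 2 := by nlinarith [sq_nonneg (a - 1)]
    refine this.trans ?_
    gcongr
  have hpi : ∀ n, Integrable (fun x => p n x * Real.log (p n x)) := fun n => by
    refine ((hui n).const_mul (L * (M + 2))).mono'
      ((hp_meas n).mul (Real.measurable_log.comp (hp_meas n))).aestronglyMeasurable ?_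
    filter_upwards [hae] with x hx
    have := bnd _ (hu0 n x) (hu2 n x hx)
    rwa [hu4] at this
  have hqi : Integrable (fun x => q x * Real.log (q x)) := by
    refine (hvi.const_mul (L * (M + 2))).mono'
      (hq_meas.mul (Real.measurable_log.comp hq_meas)).aestronglyMeasurable ?_
    filter_upwards [hae] with x hx
    have := bnd _ (hv0 x) (hv2 x hx)
    rwa [hv4] at this
  refine Tendsto.neg ?_
  rw [Metric.tendsto_atTop]
  intro ε hε
  set δ : ℝ := ε / (4 * L * B) with hδ
  have hδ0 : 0 < δ := by positivity
  obtain ⟨N, hN⟩ := h1 (δ ^ 4) (by positivity)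
  refine ⟨N, fun n hn => ?_⟩
  rw [Real.dist_eq, ← integral_sub (hpi n) hqi, ← Real.norm_eq_abs]
  have step : ‖∫ x, (p n x * Real.log (p n x) - q x * Real.log (q x))‖
      ≤ ∫ x, L * δ * (u n x + v x) := by
    refine norm_integral_le_of_norm_le (((hui n).add hvi).const_mul (L * δ)) ?_
    filter_upwards [hae] with x hx
    have k := hkey _ _ (hu0 n x) (hu2 n x hx) (hv0 x) (hv2 x hx)
    have d : |u n x - v x| ≤ δ := by
      have := (aux_pow (hu0 n x) (hv0 x))
      rw [hu4, hv4] at this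
      exact le_of_pow_le_pow_left₀ (by norm_num) hδ0.le (this.trans (hN n hn x hx).le)
    rw [hu4, hv4] at k
    refine k.trans ?_
    have := add_nonneg (hu0 n x) (hv0 x)
    gcongr
  refine step.trans_lt ?_
  rw [integral_const_mul, integral_add (hui n) hvi]
  calc L * δ * ((∫ x, u n x) + ∫ x, v x) ≤ L * δ * (B + B) := by
        gcongr
        exact huI n
    _ = ε / 2 := by rw [hδ]; field_simp; ring
    _ < ε := by linarith
end

section
/- Let {p_n} be a sequence of probability density functions on ℝ, p a probability density on ℝ, and 𝒜 ⊂ ℝ a set of Lebesgue measure zero. Suppose: (1) sup_{x ∈ ℝ∖𝒜} |p_n(x) − p(x)| → 0 as n → ∞; (2) there exists M > 0 with p_n(x) ≤ M for all n and all x ∈ ℝ∖𝒜; (3) for every α > 0 there exists M_α > 0 with ∫_ℝ p_n^α(x) dx ≤ M_α for all n. Then for every α > 0, ∫_ℝ |p_n^α(x) − p^α(x)| dx → 0 as n → ∞. -/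
open MeasureTheory Filter

/-- **Lemma 1:** under uniform convergence off a null set, a uniform bound off
that null set, and uniformly bounded `α`-integrals, the `α`-th powers of the
densities converge in `L¹` for every `α > 0`. -/
theorem pow_densities_tendsto_L1
    (p : ℕ → ℝ → ℝ) (q : ℝ → ℝ)
    (hp_nonneg : ∀ n x, 0 ≤ p n x) (hp_meas : ∀ n, Measurable (p n))
    (hp_int : ∀ n, ∫⁻ x, ENNReal.ofReal (p n x) = 1)
    (hq_nonneg : ∀ x, 0 ≤ q x) (hq_meas : Measurable q)
    (hq_int : ∫⁻ x, ENNReal.ofReal (q x) = 1)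
    (A : Set ℝ) (hA : volume A = 0)
    (h1 : ∀ ε : ℝ, 0 < ε → ∃ N : ℕ, ∀ n : ℕ, N ≤ n → ∀ x ∉ A, |p n x - q x| < ε)
    (h2 : ∃ M : ℝ, 0 < M ∧ ∀ n : ℕ, ∀ x ∉ A, p n x ≤ M)
    (h3 : ∀ α : ℝ, 0 < α → ∃ Mα : ℝ, 0 < Mα ∧ ∀ n : ℕ,
      ∫⁻ x, ENNReal.ofReal ((p n x) ^ α) ≤ ENNReal.ofReal Mα) :
    ∀ α : ℝ, 0 < α →
      Tendsto (fun n => ∫⁻ x, ENNReal.ofReal |(p n x) ^ α - (q x) ^ α|)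
        atTop (nhds 0) := by
  intro α hα
  obtain ⟨M, hM, hpM⟩ := h2
  obtain ⟨β, hβ, rfl⟩ : ∃ β : ℝ, 0 < β ∧ β + β = α := ⟨α / 2, by positivity, by ring⟩
  obtain ⟨K, hK, hpK⟩ := h3 β hβ
  have hlim : ∀ x ∉ A, Tendsto (fun n => p n x) atTop (nhds (q x)) := by
    intro x hx
    rw [Metric.tendsto_atTop]
    intro ε hε
    obtain ⟨N, hN⟩ := h1 ε hε
    exact ⟨N, fun n hn => by rw [Real.dist_eq]; exact hN n hn x hx⟩
  have hqM : ∀ x ∉ A, q x ≤ M := fun x hx =>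
    le_of_tendsto' (hlim x hx) (fun n => hpM n x hx)
  have hAe : ∀ᵐ x : ℝ, x ∉ A := measure_eq_zero_iff_ae_notMem.mp hA
  have hcont : Continuous (fun y : ℝ => y ^ β) := Real.continuous_rpow_const hβ.le
  have hqK : ∫⁻ x, ENNReal.ofReal ((q x) ^ β) ≤ ENNReal.ofReal K := by
    have e : ∫⁻ x, ENNReal.ofReal ((q x) ^ β)
        = ∫⁻ x, liminf (fun n => ENNReal.ofReal ((p n x) ^ β)) atTop := by
      apply lintegral_congr_ae
      filter_upwards [hAe] with x hx
      have : Tendsto (fun n => ENNReal.ofReal ((p n x) ^ β)) atTop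
          (nhds (ENNReal.ofReal ((q x) ^ β))) :=
        ENNReal.tendsto_ofReal ((hcont.tendsto (q x)).comp (hlim x hx))
      exact this.liminf_eq.symm
    rw [e]
    refine (lintegral_liminf_le (fun n => ?_)).trans ?_
    · exact ((hcont.measurable.comp (hp_meas n))).ennreal_ofReal
    · exact (liminf_le_liminf (Eventually.of_forall hpK)).trans (by simp)
  have huc : UniformContinuousOn (fun y : ℝ => y ^ β) (Set.Icc 0 M) :=
    isCompact_Icc.uniformContinuousOn_of_continuous hcont.continuousOn
  rw [Metric.uniformContinuousOn_iff] at huc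
  rw [ENNReal.tendsto_nhds_zero]
  intro ε hε
  rcases eq_or_ne ε ⊤ with rfl | htop
  · simp
  have hr : 0 < ε.toReal := ENNReal.toReal_pos hε.ne' htop
  obtain ⟨η, hη, hu⟩ := huc (ε.toReal / (K + K)) (by positivity)
  obtain ⟨N, hN⟩ := h1 η hη
  filter_upwards [eventually_ge_atTop N] with n hn
  set δ := ε.toReal / (K + K) with hδ
  have hδ0 : 0 ≤ δ := by positivity
  calc ∫⁻ x, ENNReal.ofReal |(p n x) ^ (β + β) - (q x) ^ (β + β)|
      ≤ ∫⁻ x, ENNReal.ofReal δ *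
          (ENNReal.ofReal ((p n x) ^ β) + ENNReal.ofReal ((q x) ^ β)) := by
        apply lintegral_mono_ae
        filter_upwards [hAe] with x hx
        have ha := Real.rpow_nonneg (hp_nonneg n x) β
        have hb := Real.rpow_nonneg (hq_nonneg x) β
        rw [← ENNReal.ofReal_add ha hb, ← ENNReal.ofReal_mul hδ0]
        apply ENNReal.ofReal_le_ofReal
        have h := hu (p n x) ⟨hp_nonneg n x, hpM n x hx⟩ (q x) ⟨hq_nonneg x, hqM x hx⟩
          (by rw [Real.dist_eq]; exact hN n hn x hx)
        rw [Real.dist_eq] at h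
        rw [Real.rpow_add_of_nonneg (hp_nonneg n x) hβ.le hβ.le,
          Real.rpow_add_of_nonneg (hq_nonneg x) hβ.le hβ.le, mul_self_sub_mul_self, abs_mul,
          abs_of_nonneg (add_nonneg ha hb), mul_comm]
        exact mul_le_mul_of_nonneg_right h.le (add_nonneg ha hb)
    _ = ENNReal.ofReal δ * ((∫⁻ x, ENNReal.ofReal ((p n x) ^ β))
          + ∫⁻ x, ENNReal.ofReal ((q x) ^ β)) := by
        have hm : Measurable (fun x => ENNReal.ofReal ((p n x) ^ β)) :=
          (hcont.measurable.comp (hp_meas n)).ennreal_ofReal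
        rw [lintegral_const_mul' _ _ ENNReal.ofReal_ne_top, lintegral_add_left hm]
    _ ≤ ENNReal.ofReal δ * (ENNReal.ofReal K + ENNReal.ofReal K) := by
        gcongr
        exact hpK n
    _ = ε := by
        rw [← ENNReal.ofReal_add hK.le hK.le, ← ENNReal.ofReal_mul hδ0, hδ,
          div_mul_cancel₀ _ (by positivity), ENNReal.ofReal_toReal htop]
end

section
/- Let {p_n} be a sequence of probability density functions on ℝ, p a probability density on ℝ, and 𝒜 ⊂ ℝ a set of Lebesgue measure zero. Suppose for every β > 0 there exists M_β > 0 with ∫_ℝ p_n^β(x) dx ≤ M_β for all n, and also ∫_ℝ p^β(x) dx ≤ M_β. Then for every α > 1, ∫_ℝ |p_n^α(x) − p^α(x)| dx ≤ 2α M_{α-1} · sup_{x ∈ ℝ∖𝒜} |p_n(x) − p(x)|. -/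
open MeasureTheory Filter

theorem rpow_sub_le_aux {a b α : ℝ} (hb : 0 ≤ b) (hab : b ≤ a) (hα : 1 < α) :
    |a ^ α - b ^ α| ≤ α * |a - b| * a ^ (α - 1) := by
  rcases hab.eq_or_lt with h | h
  · subst h; simp
  have ha : 0 < a := hb.trans_lt h
  have h1 : b ^ α ≤ a ^ α := Real.rpow_le_rpow hb hab (by linarith)
  rw [abs_of_nonneg (by linarith), abs_of_nonneg (by linarith)]
  have hdiv : 0 ≤ b / a := by positivity
  have h2 := one_add_mul_self_le_rpow_one_add (s := b / a - 1) (by linarith) hα.le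
  rw [add_sub_cancel, Real.div_rpow hb ha.le] at h2
  have hpos : 0 < a ^ α := Real.rpow_pos_of_pos ha _
  rw [le_div_iff₀ hpos] at h2
  have h3 : a ^ α = a ^ (α - 1) * a := by
    rw [Real.rpow_sub_one ha.ne', div_mul_cancel₀ _ ha.ne']
  have h4 : (1 + α * (b / a - 1)) * a ^ α = a ^ α - α * (a - b) * a ^ (α - 1) := by
    rw [h3]; field_simp; ring
  linarith

theorem rpow_sub_le_aux2 {a b α s : ℝ} (ha : 0 ≤ a) (hb : 0 ≤ b) (hα : 1 < α)
    (hs : |a - b| ≤ s) :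
    |a ^ α - b ^ α| ≤ α * s * (a ^ (α - 1) + b ^ (α - 1)) := by
  have hα0 : 0 ≤ α := by linarith
  have hs0 : 0 ≤ s := (abs_nonneg _).trans hs
  have h1 : 0 ≤ a ^ (α - 1) := Real.rpow_nonneg ha _
  have h2 : 0 ≤ b ^ (α - 1) := Real.rpow_nonneg hb _
  rcases le_total b a with h | h
  · refine (rpow_sub_le_aux hb h hα).trans ?_
    gcongr
    linarith
  · rw [abs_sub_comm] at hs ⊢
    refine (rpow_sub_le_aux ha h hα).trans ?_
    gcongr
    linarith

/-- **Quantitative `L¹` bound for the `α`-th powers, `α > 1`:**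
`∫ |pₙ^α − p^α| ≤ 2 α M_{α-1} ⋅ sup_{x ∉ A} |pₙ x − p x|`, stated for every
upper bound `s` of `|pₙ − p|` off the null set `A`. -/
theorem pow_densities_L1_bound_of_one_lt
    (p : ℕ → ℝ → ℝ) (q : ℝ → ℝ)
    (hp_nonneg : ∀ n x, 0 ≤ p n x) (hp_meas : ∀ n, Measurable (p n))
    (hp_int : ∀ n, ∫⁻ x, ENNReal.ofReal (p n x) = 1)
    (hq_nonneg : ∀ x, 0 ≤ q x) (hq_meas : Measurable q)
    (hq_int : ∫⁻ x, ENNReal.ofReal (q x) = 1)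
    (A : Set ℝ) (hA : volume A = 0)
    (M : ℝ → ℝ)
    (hM : ∀ β : ℝ, 0 < β → 0 < M β ∧
      (∀ n : ℕ, ∫⁻ x, ENNReal.ofReal ((p n x) ^ β) ≤ ENNReal.ofReal (M β)) ∧
      ∫⁻ x, ENNReal.ofReal ((q x) ^ β) ≤ ENNReal.ofReal (M β)) :
    ∀ α : ℝ, 1 < α → ∀ n : ℕ, ∀ s : ℝ, (∀ x ∉ A, |p n x - q x| ≤ s) →
      ∫⁻ x, ENNReal.ofReal |(p n x) ^ α - (q x) ^ α|
        ≤ ENNReal.ofReal (2 * α * M (α - 1) * s) := by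
  intro α hα n s hs
  obtain ⟨hM0, hMp, hMq⟩ := hM (α - 1) (by linarith)
  have hae : ∀ᵐ x, x ∉ A := measure_eq_zero_iff_ae_notMem.1 hA
  obtain ⟨x₀, hx₀⟩ := hae.exists
  have hs0 : 0 ≤ s := (abs_nonneg _).trans (hs x₀ hx₀)
  have hc : 0 ≤ α * s := mul_nonneg (by linarith) hs0
  calc ∫⁻ x, ENNReal.ofReal |(p n x) ^ α - (q x) ^ α|
      ≤ ∫⁻ x, ENNReal.ofReal (α * s) *
          (ENNReal.ofReal ((p n x) ^ (α - 1)) + ENNReal.ofReal ((q x) ^ (α - 1))) := by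
        refine lintegral_mono_ae ?_
        filter_upwards [hae] with x hx
        rw [← ENNReal.ofReal_add (Real.rpow_nonneg (hp_nonneg n x) _)
          (Real.rpow_nonneg (hq_nonneg x) _), ← ENNReal.ofReal_mul hc]
        exact ENNReal.ofReal_le_ofReal
          (rpow_sub_le_aux2 (hp_nonneg n x) (hq_nonneg x) hα (hs x hx))
    _ = ENNReal.ofReal (α * s) * ((∫⁻ x, ENNReal.ofReal ((p n x) ^ (α - 1))) +
          ∫⁻ x, ENNReal.ofReal ((q x) ^ (α - 1))) := by
        rw [lintegral_const_mul' _ _ ENNReal.ofReal_ne_top,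
          lintegral_add_left ((hp_meas n).pow_const _).ennreal_ofReal]
    _ ≤ ENNReal.ofReal (α * s) * (ENNReal.ofReal (M (α - 1)) + ENNReal.ofReal (M (α - 1))) := by
        gcongr
        exact hMp n
    _ = ENNReal.ofReal (2 * α * M (α - 1) * s) := by
        rw [← ENNReal.ofReal_add hM0.le hM0.le, ← ENNReal.ofReal_mul hc]
        congr 1
        ring
end

section
/- Let {p_n} be a sequence of probability density functions on ℝ, p a probability density on ℝ, and 𝒜 ⊂ ℝ a set of Lebesgue measure zero. Let 0 < α ≤ 1 and γ ∈ (0, α/2), and suppose there exists M_{2γ} > 0 with ∫_ℝ p_n^{2γ}(x) dx ≤ M_{2γ} for all n and ∫_ℝ p^{2γ}(x) dx ≤ M_{2γ}. Then ∫_ℝ |p_n^α(x) − p^α(x)| dx ≤ 2^{2γ+1} M_{2γ} · (sup_{x ∈ ℝ∖𝒜} |p_n(x) − p(x)|)^{α − 2γ}. -/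
open MeasureTheory Filter

lemma aux_ptwise {a b α γ s : ℝ} (hb : 0 ≤ b) (hab : b ≤ a) (hα : 0 < α) (hα1 : α ≤ 1)
    (hγ : 0 < γ) (hγα : γ < α / 2) (h : a - b ≤ s) :
    |a ^ α - b ^ α| ≤ s ^ (α - 2 * γ) * (a ^ (2 * γ) + b ^ (2 * γ)) := by
  have hd : 0 ≤ a - b := by linarith
  have h1 : a ^ α ≤ (a - b) ^ α + b ^ α := by
    have := Real.rpow_add_le_add_rpow hd hb hα.le hα1
    simpa using this
  have h2 : b ^ α ≤ a ^ α := Real.rpow_le_rpow hb hab hα.le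
  have h3 : (a - b) ^ α = (a - b) ^ (α - 2 * γ) * (a - b) ^ (2 * γ) := by
    rw [← Real.rpow_add_of_nonneg hd (by linarith) (by linarith)]
    congr 1
    ring
  have h4 : (a - b) ^ (α - 2 * γ) ≤ s ^ (α - 2 * γ) :=
    Real.rpow_le_rpow hd h (by linarith)
  have h5 : (a - b) ^ (2 * γ) ≤ a ^ (2 * γ) :=
    Real.rpow_le_rpow hd (by linarith) (by linarith)
  have h6 : 0 ≤ b ^ (2 * γ) := Real.rpow_nonneg hb _
  have h7 : 0 ≤ (a - b) ^ (2 * γ) := Real.rpow_nonneg hd _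
  have h8 : 0 ≤ s ^ (α - 2 * γ) := Real.rpow_nonneg (hd.trans h) _
  rw [abs_of_nonneg (by linarith)]
  calc a ^ α - b ^ α ≤ (a - b) ^ (α - 2 * γ) * (a - b) ^ (2 * γ) := by linarith
    _ ≤ s ^ (α - 2 * γ) * (a ^ (2 * γ) + b ^ (2 * γ)) :=
      mul_le_mul h4 (by linarith) h7 h8

/-- **Quantitative `L¹` bound for the `α`-th powers, `0 < α ≤ 1`:**
for `γ ∈ (0, α/2)`,
`∫ |pₙ^α − p^α| ≤ 2^{2γ+1} M_{2γ} ⋅ (sup_{x ∉ A} |pₙ x − p x|)^{α−2γ}`,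
stated for every upper bound `s` of `|pₙ − p|` off the null set `A`. -/
theorem pow_densities_L1_bound_of_le_one
    (p : ℕ → ℝ → ℝ) (q : ℝ → ℝ)
    (hp_nonneg : ∀ n x, 0 ≤ p n x) (hp_meas : ∀ n, Measurable (p n))
    (hp_int : ∀ n, ∫⁻ x, ENNReal.ofReal (p n x) = 1)
    (hq_nonneg : ∀ x, 0 ≤ q x) (hq_meas : Measurable q)
    (hq_int : ∫⁻ x, ENNReal.ofReal (q x) = 1)
    (A : Set ℝ) (hA : volume A = 0)
    (α γ : ℝ) (hα : 0 < α) (hα1 : α ≤ 1) (hγ : 0 < γ) (hγα : γ < α / 2)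
    (M2γ : ℝ) (hM2γ : 0 < M2γ)
    (hp_bd : ∀ n : ℕ, ∫⁻ x, ENNReal.ofReal ((p n x) ^ (2 * γ))
      ≤ ENNReal.ofReal M2γ)
    (hq_bd : ∫⁻ x, ENNReal.ofReal ((q x) ^ (2 * γ)) ≤ ENNReal.ofReal M2γ) :
    ∀ n : ℕ, ∀ s : ℝ, (∀ x ∉ A, |p n x - q x| ≤ s) →
      ∫⁻ x, ENNReal.ofReal |(p n x) ^ α - (q x) ^ α|
        ≤ ENNReal.ofReal ((2 : ℝ) ^ (2 * γ + 1) * M2γ * s ^ (α - 2 * γ)) := by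
  intro n s hs
  have hae : ∀ᵐ x : ℝ, x ∉ A := measure_eq_zero_iff_ae_notMem.mp hA
  obtain ⟨x0, hx0⟩ := hae.exists
  have hs0 : 0 ≤ s := (abs_nonneg _).trans (hs x0 hx0)
  have hS : 0 ≤ s ^ (α - 2 * γ) := Real.rpow_nonneg hs0 _
  have hm : Measurable fun x => ENNReal.ofReal ((p n x) ^ (2 * γ)) :=
    ((hp_meas n).pow_const _).ennreal_ofReal
  have hmq : Measurable fun x => ENNReal.ofReal ((q x) ^ (2 * γ)) :=
    (hq_meas.pow_const _).ennreal_ofReal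
  have key : ∀ᵐ x : ℝ, ENNReal.ofReal |(p n x) ^ α - (q x) ^ α| ≤
      ENNReal.ofReal (s ^ (α - 2 * γ)) *
        (ENNReal.ofReal ((p n x) ^ (2 * γ)) + ENNReal.ofReal ((q x) ^ (2 * γ))) := by
    filter_upwards [hae] with x hx
    rw [← ENNReal.ofReal_add (Real.rpow_nonneg (hp_nonneg n x) _)
      (Real.rpow_nonneg (hq_nonneg x) _), ← ENNReal.ofReal_mul hS]
    apply ENNReal.ofReal_le_ofReal
    have hb := abs_le.mp (hs x hx)
    rcases le_total (q x) (p n x) with h | h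
    · exact aux_ptwise (hq_nonneg x) h hα hα1 hγ hγα hb.2
    · rw [abs_sub_comm, add_comm]
      exact aux_ptwise (hp_nonneg n x) h hα hα1 hγ hγα (by linarith [hb.1])
  refine (lintegral_mono_ae key).trans ?_
  rw [lintegral_const_mul' _ _ ENNReal.ofReal_ne_top, lintegral_add_left hm]
  refine (mul_le_mul_right (add_le_add (hp_bd n) hq_bd) _).trans ?_
  rw [← ENNReal.ofReal_add hM2γ.le hM2γ.le, ← ENNReal.ofReal_mul hS]
  apply ENNReal.ofReal_le_ofReal
  have h2 : (2 : ℝ) ≤ 2 ^ (2 * γ + 1) := by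
    have := Real.rpow_le_rpow_of_exponent_le (x := 2) (by norm_num)
      (show (1 : ℝ) ≤ 2 * γ + 1 by linarith)
    simpa using this
  have h3 := mul_le_mul_of_nonneg_right h2 (mul_nonneg hM2γ.le hS)
  linarith
end

section
/- For every γ ∈ (0, 1/2) there exists Q_γ > 0 such that for all x, y ∈ [0, 1], Q_γ |x^{1-γ} − y^{1-γ}| ≥ |x^γ y^{1-γ} log x − y^γ x^{1-γ} log y|, where the expressions x^γ y^{1-γ} log x and y^γ x^{1-γ} log y are interpreted as 0 when the corresponding variable equals 0. -/
open MeasureTheory Filter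

theorem log_pow_aux (γ : ℝ) (h0 : 0 < γ) (h1 : γ < 1 / 2) (x y : ℝ) (hy : 0 < y) (hyx : y ≤ x)
    (hx1 : x ≤ 1) :
    |x ^ γ * y ^ (1 - γ) * Real.log x - y ^ γ * x ^ (1 - γ) * Real.log y|
      ≤ 2 / γ * (x ^ (1 - γ) - y ^ (1 - γ)) := by
  have hx : 0 < x := hy.trans_le hyx
  have hP : x ^ (1 - γ) = x ^ γ * x ^ (1 - 2 * γ) := by
    rw [← Real.rpow_add hx]; congr 1; ring
  have hR : y ^ (1 - γ) = y ^ γ * y ^ (1 - 2 * γ) := by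
    rw [← Real.rpow_add hy]; congr 1; ring
  have hst : y ^ (1 - 2 * γ) ≤ x ^ (1 - 2 * γ) :=
    Real.rpow_le_rpow hy.le hyx (by linarith)
  have hqp : y ^ γ ≤ x ^ γ := Real.rpow_le_rpow hy.le hyx h0.le
  have hRP : y ^ (1 - γ) ≤ x ^ (1 - γ) := Real.rpow_le_rpow hy.le hyx (by linarith)
  have hp1 : x ^ γ ≤ 1 := Real.rpow_le_one hx.le hx1 h0.le
  have hp : 0 < x ^ γ := Real.rpow_pos_of_pos hx _
  have hq : 0 < y ^ γ := Real.rpow_pos_of_pos hy _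
  have hPp : 0 < x ^ (1 - γ) := Real.rpow_pos_of_pos hx _
  have hu : Real.log x ≤ 0 := Real.log_nonpos hx.le hx1
  have hv : Real.log y ≤ Real.log x := Real.log_le_log hy hyx
  have hcross : x ^ γ * y ^ (1 - γ) ≤ y ^ γ * x ^ (1 - γ) := by
    rw [hP, hR]
    have := mul_le_mul_of_nonneg_left hst (mul_pos hp hq).le
    linarith
  -- logarithm bounds
  have l1 : γ * (-Real.log x) * x ^ γ ≤ 1 := by
    have := Real.one_sub_inv_le_log_of_pos hp
    rw [Real.log_rpow hx] at this
    have h := mul_le_mul_of_nonneg_right this hp.le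
    rw [sub_mul, inv_mul_cancel₀ hp.ne'] at h
    linarith
  have l2 : γ * (Real.log x - Real.log y) * y ^ γ ≤ x ^ γ - y ^ γ := by
    have := Real.log_le_sub_one_of_pos (div_pos hp hq)
    rw [Real.log_div hp.ne' hq.ne', Real.log_rpow hx, Real.log_rpow hy] at this
    have h := mul_le_mul_of_nonneg_right this hq.le
    rw [sub_mul (x ^ γ / y ^ γ), div_mul_cancel₀ _ hq.ne'] at h
    linarith
  generalize x ^ γ = p at *
  generalize y ^ γ = q at *
  generalize x ^ (1 - γ) = P at *
  generalize y ^ (1 - γ) = R at *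
  generalize Real.log x = u at *
  generalize Real.log y = v at *
  have e : p * R * u - q * P * v = (-u) * (q * P - p * R) + q * P * (u - v) := by ring
  have n1 : 0 ≤ (-u) * (q * P - p * R) := mul_nonneg (by linarith) (by linarith)
  have n2 : 0 ≤ q * P * (u - v) := mul_nonneg (by positivity) (by linarith)
  rw [e, abs_of_nonneg (by linarith), div_mul_eq_mul_div, le_div_iff₀ h0]
  have b1 : (-u) * (q * P - p * R) * γ ≤ P - R := by
    have a1 : q * P - p * R ≤ p * (P - R) := by nlinarith
    have a2 := mul_le_mul_of_nonneg_left a1 (mul_nonneg h0.le (neg_nonneg.2 hu))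
    have a3 := mul_le_mul_of_nonneg_right l1 (sub_nonneg.2 hRP)
    linarith
  have b2 : q * P * (u - v) * γ ≤ P - R := by
    have a1 := mul_le_mul_of_nonneg_right l2 hPp.le
    have a2 := mul_le_mul_of_nonneg_right hp1 (sub_nonneg.2 hRP)
    linarith
  linarith

/-- **Lemma 4:** for every `γ ∈ (0, 1/2)` there is `Q_γ > 0` such that for all
`x, y ∈ [0, 1]`,
`|x^γ y^{1-γ} log x − y^γ x^{1-γ} log y| ≤ Q_γ |x^{1-γ} − y^{1-γ}|`.
(With Lean's conventions `0 ^ β = 0` for `β > 0` and `log 0 = 0`, the left-hand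
terms vanish when the corresponding variable is `0`.) -/
theorem log_pow_inequality :
    ∀ γ : ℝ, 0 < γ → γ < 1 / 2 → ∃ Q : ℝ, 0 < Q ∧
      ∀ x y : ℝ, x ∈ Set.Icc (0 : ℝ) 1 → y ∈ Set.Icc (0 : ℝ) 1 →
        |x ^ γ * y ^ (1 - γ) * Real.log x - y ^ γ * x ^ (1 - γ) * Real.log y|
          ≤ Q * |x ^ (1 - γ) - y ^ (1 - γ)| := by
  intro γ h0 h1
  refine ⟨2 / γ, by positivity, ?_⟩
  rintro x y ⟨hx0, hx1⟩ ⟨hy0, hy1⟩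
  have hg : γ ≠ 0 := h0.ne'
  have hg1 : 1 - γ ≠ 0 := by
    intro h
    linarith
  rcases hx0.eq_or_lt with rfl | hx
  · rw [Real.zero_rpow hg, Real.zero_rpow hg1]
    simp only [zero_mul, mul_zero, sub_zero, abs_zero]
    positivity
  rcases hy0.eq_or_lt with rfl | hy
  · rw [Real.zero_rpow hg, Real.zero_rpow hg1]
    simp only [zero_mul, mul_zero, sub_zero, abs_zero]
    positivity
  rcases le_total y x with h | h
  · exact (log_pow_aux γ h0 h1 x y hy h hx1).trans
      (mul_le_mul_of_nonneg_left (le_abs_self _) (by positivity))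
  · rw [abs_sub_comm, abs_sub_comm (x ^ (1 - γ))]
    exact (log_pow_aux γ h0 h1 y x hx h hy1).trans
      (mul_le_mul_of_nonneg_left (le_abs_self _) (by positivity))
end
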